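/- arXiv:1812.05346 — 2 statements merged into one kernel-verified Lean document; each statement's English description precedes it below -/
import Mathlib

section
/- Let r > 0 and let v be a tempered distribution on ℝ, i.e. a continuous linear functional on the space of Schwartz functions ℝ → ℂ. Then the following are equivalent: (i) there exists γ ∈ ℂ such that v(f) = γ·√r·∑_{k∈ℤ} f(rk) for every Schwartz function f; (ii) v(x ↦ f(x + r)) = v(f) and v(x ↦ exp(2πi·x/r)·f(x)) = v(f) for every Schwartz function f. (In other words, a distribution is a constant multiple of the Dirac comb Ш_r if and only if it is invariant under the shifts S_{(r,0)} and S_{(0,1/r)}.) -/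
open scoped SchwartzMap FourierTransform ContDiff
open Filter Topology

/-- The smooth step function `Real.smoothTransition`, with complex values. -/
noncomputable def smoothStep (x : ℝ) : ℂ := (Real.smoothTransition x : ℂ)

lemma smoothStep_contDiff : ContDiff ℝ ∞ smoothStep :=
  Complex.ofRealCLM.contDiff.comp Real.smoothTransition.contDiff

lemma smoothStep_of_nonpos {x : ℝ} (hx : x ≤ 0) : smoothStep x = 0 := by
  simp [smoothStep, Real.smoothTransition.zero_of_nonpos hx]

lemma smoothStep_of_one_le {x : ℝ} (hx : 1 ≤ x) : smoothStep x = 1 := by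
  simp [smoothStep, Real.smoothTransition.one_of_one_le hx]

lemma smoothStep_one_sub (x : ℝ) : smoothStep (1 - x) = 1 - smoothStep x := by
  have h := (Real.smoothTransition.pos_denom x).ne'
  have key : Real.smoothTransition (1 - x) = 1 - Real.smoothTransition x := by
    rw [Real.smoothTransition, Real.smoothTransition, sub_sub_cancel,
      add_comm (expNegInvGlue (1 - x)), eq_sub_iff_add_eq, ← add_div, add_comm, div_self h]
  simp [smoothStep, key]

lemma iteratedFDeriv_smoothStep_of_neg (n : ℕ) {x : ℝ} (hx : x < 0) :
    iteratedFDeriv ℝ n smoothStep x = 0 := by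
  have h : smoothStep =ᶠ[𝓝 x] fun _ => 0 := by
    filter_upwards [Iio_mem_nhds hx] with y hy using smoothStep_of_nonpos (le_of_lt hy)
  rw [(h.iteratedFDeriv ℝ n).eq_of_nhds]
  simp

lemma exists_norm_iteratedFDeriv_smoothStep_le (n : ℕ) :
    ∃ C : ℝ, ∀ x, ‖iteratedFDeriv ℝ n smoothStep x‖ ≤ C := by
  obtain ⟨C, hC⟩ := (isCompact_Icc (a := (0 : ℝ)) (b := 1)).exists_bound_of_continuousOn
    (smoothStep_contDiff.continuous_iteratedFDeriv (m := n) (mod_cast le_top)).continuousOn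
  refine ⟨max C 1, fun x => ?_⟩
  rcases lt_or_ge x 0 with h0 | h0
  · rw [iteratedFDeriv_smoothStep_of_neg n h0]
    simp
  rcases le_or_gt x 1 with h1 | h1
  · exact (hC x ⟨h0, h1⟩).trans (le_max_left _ _)
  · have h : smoothStep =ᶠ[𝓝 x] fun _ => 1 := by
      filter_upwards [Ioi_mem_nhds h1] with y hy using smoothStep_of_one_le (le_of_lt hy)
    rw [(h.iteratedFDeriv ℝ n).eq_of_nhds]
    refine le_trans ?_ (le_max_right _ _)
    rcases eq_or_ne n 0 with rfl | hn
    · simp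
    · simp [iteratedFDeriv_const_of_ne hn]

namespace SchwartzMap

/-- A series of smooth functions whose Schwartz seminorms are summable has a Schwartz sum. -/
lemma exists_eq_tsum {ι : Type*} {u : ι → ℝ → ℂ} {b : ι → ℝ} (hu : ∀ k, ContDiff ℝ ∞ (u k))
    (hb : Summable b)
    (h : ∀ p n : ℕ, ∃ C : ℝ, ∀ k x, ‖x‖ ^ p * ‖iteratedFDeriv ℝ n (u k) x‖ ≤ C * b k) :
    ∃ g : 𝓢(ℝ, ℂ), ∀ x, g x = ∑' k, u k x := by
  choose C hC using h
  have hs : ∀ n : ℕ, (n : ℕ∞) ≤ (⊤ : ℕ∞) → Summable fun k => C 0 n * b k :=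
    fun n _ => hb.mul_left _
  have hle : ∀ (n : ℕ) (k : ι) (x : ℝ), (n : ℕ∞) ≤ (⊤ : ℕ∞) →
      ‖iteratedFDeriv ℝ n (u k) x‖ ≤ C 0 n * b k :=
    fun n k x _ => by simpa using hC 0 n k x
  refine ⟨⟨fun x => ∑' k, u k x, contDiff_tsum hu hs hle, fun p n => ?_⟩, fun x => rfl⟩
  refine ⟨∑' k, C p n * b k, fun x => ?_⟩
  rw [iteratedFDeriv_tsum_apply hu hs hle (by simp) x]
  have hsn : Summable fun k => ‖iteratedFDeriv ℝ n (u k) x‖ :=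
    Summable.of_nonneg_of_le (fun _ => norm_nonneg _) (fun k => hle n k x (by simp))
      (hs n (by simp))
  calc ‖x‖ ^ p * ‖∑' k, iteratedFDeriv ℝ n (u k) x‖
      ≤ ‖x‖ ^ p * ∑' k, ‖iteratedFDeriv ℝ n (u k) x‖ := by
        gcongr
        exact norm_tsum_le_tsum_norm hsn
    _ = ∑' k, ‖x‖ ^ p * ‖iteratedFDeriv ℝ n (u k) x‖ := tsum_mul_left.symm
    _ ≤ ∑' k, C p n * b k :=
        (hsn.mul_left _).tsum_le_tsum (hC p n · x) (hb.mul_left _)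

lemma exists_one_add_norm_pow_mul_le (f : 𝓢(ℝ, ℂ)) (p n : ℕ) :
    ∃ C : ℝ, ∀ x, (1 + ‖x‖) ^ p * ‖iteratedFDeriv ℝ n f x‖ ≤ C :=
  ⟨_, fun x => one_add_le_sup_seminorm_apply (𝕜 := ℝ) (m := (p, n)) le_rfl le_rfl f x⟩

lemma exists_eq_smoothStep_mul_tsum (f : 𝓢(ℝ, ℂ)) :
    ∃ g : 𝓢(ℝ, ℂ), ∀ x, g x = smoothStep x * ∑' k : ℕ, f (x + k) := by
  have hshift : ∀ k : ℕ, ContDiff ℝ ∞ fun x : ℝ => f (x + k) := fun k =>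
    (f.smooth ⊤).comp (contDiff_id.add contDiff_const)
  have hb : Summable fun k : ℕ => 1 / ((k : ℝ) + 1) ^ 2 :=
    mod_cast (summable_nat_add_iff 1).2 (Real.summable_one_div_nat_pow.2 one_lt_two)
  obtain ⟨g, hg⟩ := exists_eq_tsum (u := fun (k : ℕ) x => smoothStep x * f (x + k))
    (fun k => smoothStep_contDiff.mul (hshift k)) hb fun p n => by
      choose A hA using exists_norm_iteratedFDeriv_smoothStep_le
      choose B hB using f.exists_one_add_norm_pow_mul_le (p + 2)
      have hA0 : ∀ i, 0 ≤ A i := fun i => (norm_nonneg _).trans (hA i 0)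
      have hB0 : ∀ i, 0 ≤ B i := fun i => le_trans (by positivity) (hB i 0)
      refine ⟨∑ i ∈ Finset.range (n + 1), (n.choose i : ℝ) * A i * B (n - i), fun k x => ?_⟩
      have hk : (0 : ℝ) < ((k : ℝ) + 1) ^ 2 := by positivity
      rw [mul_one_div, le_div_iff₀ hk]
      have hL := norm_iteratedFDeriv_mul_le (n := n) smoothStep_contDiff (hshift k) x
        (mod_cast le_top)
      calc ‖x‖ ^ p * ‖iteratedFDeriv ℝ n (fun x => smoothStep x * f (x + k)) x‖ * ((k : ℝ) + 1) ^ 2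
          ≤ ‖x‖ ^ p * (∑ i ∈ Finset.range (n + 1), (n.choose i : ℝ) *
              ‖iteratedFDeriv ℝ i smoothStep x‖ *
              ‖iteratedFDeriv ℝ (n - i) (fun x : ℝ => f (x + k)) x‖) * ((k : ℝ) + 1) ^ 2 := by
            gcongr
        _ = ∑ i ∈ Finset.range (n + 1), (n.choose i : ℝ) *
              ‖iteratedFDeriv ℝ i smoothStep x‖ *
              (‖x‖ ^ p * ((k : ℝ) + 1) ^ 2 * ‖iteratedFDeriv ℝ (n - i) f (x + k)‖) := by
            rw [Finset.mul_sum, Finset.sum_mul]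
            refine Finset.sum_congr rfl fun i _ => ?_
            rw [iteratedFDeriv_comp_add_right]
            ring
        _ ≤ _ := by
            refine Finset.sum_le_sum fun i _ => ?_
            rcases lt_or_ge x 0 with hx | hx
            · rw [iteratedFDeriv_smoothStep_of_neg i hx]
              have := hA0 i
              have := hB0 (n - i)
              simp only [norm_zero, mul_zero, zero_mul]
              positivity
            · have hxk : ‖x + k‖ = x + k := Real.norm_of_nonneg (by positivity)
              have hw : ‖x‖ ^ p * ((k : ℝ) + 1) ^ 2 ≤ (1 + ‖x + k‖) ^ (p + 2) := by
                rw [hxk, Real.norm_of_nonneg hx, pow_add]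
                have hk0 : (0 : ℝ) ≤ k := k.cast_nonneg
                gcongr ?_ ^ p * ?_ ^ 2 <;> linarith
              have := hA0 i
              gcongr
              · exact hA i x
              · exact (mul_le_mul_of_nonneg_right hw (norm_nonneg _)).trans (hB (n - i) (x + k))
  exact ⟨g, fun x => by rw [hg, tsum_mul_left]⟩

lemma summable_add_int (f : 𝓢(ℝ, ℂ)) (x : ℝ) : Summable fun n : ℤ => f (x + n) := by
  have h := summable_of_isBigO (Real.summable_abs_int_rpow one_lt_two)
    (((f.compSubConstCLM ℝ (-x)).isBigO_cocompact_rpow (-2)).comp_tendsto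
      Int.tendsto_coe_cofinite)
  simpa [Function.comp_def, add_comm] using h

/-- Up to a coboundary `G (x + 1) - G x`, a Schwartz function is its periodization times a fixed
cutoff. -/
lemma exists_add_one_sub_eq (f : 𝓢(ℝ, ℂ)) :
    ∃ G : 𝓢(ℝ, ℂ), ∀ x, G (x + 1) - G x =
      f x - (smoothStep (x + 1) - smoothStep x) * ∑' n : ℤ, f (x + n) := by
  let neg : 𝓢(ℝ, ℂ) →L[ℝ] 𝓢(ℝ, ℂ) := compCLMOfContinuousLinearEquiv ℝ (ContinuousLinearEquiv.neg ℝ)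
  have hneg : ∀ (h : 𝓢(ℝ, ℂ)) x, neg h x = h (-x) := fun h x => rfl
  obtain ⟨U, hU⟩ := f.exists_eq_smoothStep_mul_tsum
  obtain ⟨V, hV⟩ := (neg f).exists_eq_smoothStep_mul_tsum
  refine ⟨(neg V).compSubConstCLM ℝ 1 - U, fun x => ?_⟩
  have hs := f.summable_add_int x
  have hpos : Summable fun n : ℕ => f (x + n) := by
    simpa [Function.comp_def] using hs.comp_injective (Nat.cast_injective (R := ℤ))
  have hnegs : Summable fun n : ℕ => f (x - n) := by
    simpa [Function.comp_def, ← sub_eq_add_neg] using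
      hs.comp_injective (neg_injective.comp (Nat.cast_injective (R := ℤ)))
  have e1 : ∑' n : ℕ, f (x + n) = f x + ∑' n : ℕ, f (x + 1 + n) := by
    rw [hpos.tsum_eq_zero_add]
    simp [add_assoc, add_comm (1 : ℝ)]
  have e2 : ∑' n : ℕ, f (x - n) = f x + ∑' n : ℕ, f (x - 1 - n) := by
    rw [hnegs.tsum_eq_zero_add]
    simp [sub_sub, add_comm (1 : ℝ)]
  have e3 : ∑' n : ℤ, f (x + n) = ∑' n : ℕ, f (x + n) + ∑' n : ℕ, f (x - 1 - n) := by
    rw [tsum_of_nat_of_neg_add_one (by simpa using hpos)]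
    · congr 2
      ext n
      congr 1
      push_cast
      ring
    · have := (summable_nat_add_iff 1).2 hnegs
      refine this.congr fun n => ?_
      congr 1
      push_cast
      ring
  have w : ∀ y, V (1 - y) = (1 - smoothStep y) * ∑' n : ℕ, f (y - 1 - n) := fun y => by
    rw [hV, smoothStep_one_sub]
    congr 2
    ext n
    rw [hneg]
    congr 1
    ring
  have c1 : -(x + 1 - 1) = 1 - (x + 1) := by ring
  have c2 : -(x - 1) = 1 - x := by ring
  simp only [sub_apply, compSubConstCLM_apply, hneg, c1, c2, w, hU, e3]
  rw [add_sub_cancel_right, e1, e2]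
  ring

lemma fourier_add_one_apply {g h : 𝓢(ℝ, ℂ)} (hgh : ∀ x, h x = g (x + 1)) (x : ℝ) :
    𝓕 h x = Complex.exp (2 * (Real.pi : ℂ) * Complex.I * x) * 𝓕 g x := by
  have hh : (h : ℝ → ℂ) = g ∘ fun x => x + 1 := funext hgh
  rw [fourier_coe, fourier_coe, hh]
  refine (congrFun (VectorFourier.fourierIntegral_comp_add_right Real.fourierChar
    MeasureTheory.volume (innerₗ ℝ) g 1) x).trans ?_
  rw [Circle.smul_def, Real.fourierChar_apply, smul_eq_mul]
  congr 2
  simp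
  ring

/-- Schwartz functions vanishing on `ℤ` are annihilated by every distribution that is invariant
under multiplication by `exp (2πix)`. -/
lemma apply_eq_zero_of_modulation_invariant {v : 𝓢(ℝ, ℂ) →L[ℂ] ℂ}
    (hv : ∀ f g : 𝓢(ℝ, ℂ),
      (∀ x : ℝ, g x = Complex.exp (2 * (Real.pi : ℂ) * Complex.I * x) * f x) → v g = v f)
    {f : 𝓢(ℝ, ℂ)} (hf : ∀ n : ℤ, f n = 0) : v f = 0 := by
  obtain ⟨G, hG⟩ := (𝓕⁻ f).exists_add_one_sub_eq
  have hP : ∀ x : ℝ, ∑' n : ℤ, (𝓕⁻ f) (x + n) = 0 := fun x => by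
    rw [SchwartzMap.tsum_eq_tsum_fourier]
    simp [hf]
  have hF : 𝓕⁻ f = G.compSubConstCLM ℂ (-1) - G := by
    ext x
    simpa [hP] using (hG x).symm
  have hf' : f = 𝓕 (G.compSubConstCLM ℂ (-1)) - 𝓕 G := by
    rw [← fourierTransformCLM_apply ℂ, ← fourierTransformCLM_apply ℂ, ← map_sub, ← hF,
      fourierTransformCLM_apply, FourierTransform.fourier_fourierInv_eq]
  rw [hf', map_sub, sub_eq_zero]
  exact hv _ _ (fourier_add_one_apply fun x => by simp)

lemma apply_eq_mul_tsum_of_invariant {v : 𝓢(ℝ, ℂ) →L[ℂ] ℂ}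
    (hT : ∀ f g : 𝓢(ℝ, ℂ), (∀ x : ℝ, g x = f (x + 1)) → v g = v f)
    (hM : ∀ f g : 𝓢(ℝ, ℂ),
      (∀ x : ℝ, g x = Complex.exp (2 * (Real.pi : ℂ) * Complex.I * x) * f x) → v g = v f) :
    ∃ γ : ℂ, ∀ f : 𝓢(ℝ, ℂ), v f = γ * ∑' n : ℤ, f n := by
  have hcs : HasCompactSupport fun x => smoothStep (x + 1) - smoothStep x := by
    refine HasCompactSupport.intro (isCompact_Icc (a := (-1 : ℝ)) (b := 1)) fun x hx => ?_
    rcases lt_or_ge x (-1) with h | h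
    · rw [smoothStep_of_nonpos (by linarith), smoothStep_of_nonpos (by linarith), sub_self]
    · have : 1 < x := by
        by_contra! h'
        exact hx ⟨h, h'⟩
      rw [smoothStep_of_one_le (by linarith), smoothStep_of_one_le (by linarith), sub_self]
  let χ : 𝓢(ℝ, ℂ) := hcs.toSchwartzMap
    ((smoothStep_contDiff.comp (contDiff_id.add contDiff_const)).sub smoothStep_contDiff)
  have hχ : ∀ x, χ x = smoothStep (x + 1) - smoothStep x := fun x => rfl
  refine ⟨v χ, fun f => ?_⟩
  obtain ⟨G, hG⟩ := f.exists_add_one_sub_eq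
  have hGv : v (G.compSubConstCLM ℂ (-1)) = v G := hT _ _ fun x => by simp
  have h0 : v (f - (G.compSubConstCLM ℂ (-1) - G) - (∑' n : ℤ, f n) • χ) = 0 := by
    refine apply_eq_zero_of_modulation_invariant hM fun m => ?_
    have hper : ∑' n : ℤ, f ((m : ℝ) + n) = ∑' n : ℤ, f n := by
      simpa using (Equiv.addLeft m).tsum_eq fun n : ℤ => f n
    have := hG m
    rw [hper] at this
    simp only [sub_apply, smul_apply, compSubConstCLM_apply, sub_neg_eq_add, this, hχ,
      smul_eq_mul]
    ring
  simp only [map_sub, map_smul, hGv, sub_self, sub_zero, smul_eq_mul] at h0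
  rw [sub_eq_zero.1 h0, mul_comm]

end SchwartzMap

/-- A tempered distribution is a constant multiple of the Dirac comb `Ш_r` if and only if
it is invariant under the shifts `S_{(r,0)}` and `S_{(0,1/r)}`. -/
theorem stmt12 (r : ℝ) (hr : 0 < r) (v : SchwartzMap ℝ ℂ →L[ℂ] ℂ) :
    (∃ γ : ℂ, ∀ f : SchwartzMap ℝ ℂ,
        v f = γ * ((Real.sqrt r : ℂ) * ∑' k : ℤ, f (r * k)))
    ↔ ((∀ f g : SchwartzMap ℝ ℂ, (∀ x : ℝ, g x = f (x + r)) → v g = v f) ∧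
       (∀ f g : SchwartzMap ℝ ℂ,
          (∀ x : ℝ, g x = Complex.exp (2 * (Real.pi : ℂ) * Complex.I * (x : ℂ) / (r : ℂ)) * f x)
          → v g = v f)) := by
  have hr0 : (r : ℂ) ≠ 0 := mod_cast hr.ne'
  constructor
  · rintro ⟨γ, hγ⟩
    refine ⟨fun f g h => ?_, fun f g h => ?_⟩
    · rw [hγ, hγ, ← (Equiv.addRight (1 : ℤ)).tsum_eq fun k : ℤ => f (r * k)]
      congr 3
      ext k
      rw [h]
      congr 1
      simp [mul_add]
    · rw [hγ, hγ]
      congr 3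
      ext k
      rw [h]
      have : 2 * (Real.pi : ℂ) * Complex.I * ((r * k : ℝ) : ℂ) / r =
          k * (2 * Real.pi * Complex.I) := by
        push_cast
        field_simp
      rw [this, Complex.exp_int_mul_two_pi_mul_I, one_mul]
  · rintro ⟨hT, hM⟩
    let dil (c : ℝ) (hc : c ≠ 0) : 𝓢(ℝ, ℂ) →L[ℂ] 𝓢(ℝ, ℂ) :=
      SchwartzMap.compCLMOfContinuousLinearEquiv ℂ
        (ContinuousLinearEquiv.smulLeft (Units.mk0 c hc))
    have hdil : ∀ c hc (f : 𝓢(ℝ, ℂ)) x, dil c hc f x = f (c * x) := fun c hc f x => rfl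
    obtain ⟨γ, hγ⟩ := SchwartzMap.apply_eq_mul_tsum_of_invariant
      (v := v.comp (dil r⁻¹ (inv_ne_zero hr.ne')))
      (fun f g h => hT _ _ fun x => by
        change g (r⁻¹ * x) = f (r⁻¹ * (x + r))
        rw [h]
        congr 1
        field_simp)
      (fun f g h => hM _ _ fun x => by
        change g (r⁻¹ * x) = _ * f (r⁻¹ * x)
        rw [h]
        congr 2
        push_cast
        field_simp)
    have hs : (Real.sqrt r : ℂ) ≠ 0 := mod_cast (Real.sqrt_pos.2 hr).ne'
    refine ⟨γ / Real.sqrt r, fun f => ?_⟩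
    have hf : dil r⁻¹ (inv_ne_zero hr.ne') (dil r hr.ne' f) = f := by
      ext x
      rw [hdil, hdil, mul_inv_cancel_left₀ hr.ne']
    have := hγ (dil r hr.ne' f)
    rw [ContinuousLinearMap.comp_apply, hf] at this
    rw [this, ← mul_assoc, div_mul_cancel₀ _ hs]
    rfl
end

section
/- Let M = (a b; c d) be a 2×2 integer matrix with ad − bc = 1 and b > 0, and let q, p ∈ ℤ with q ≡ ab (mod 2) and p ≡ cd (mod 2). Define E(n) = −(d/(2b))·(n − q/2)² − (1/2)·p·n + (1/8)·q·p. Suppose μ ∈ ℂ satisfies ⟨S_{(q/2,p/2)}𝓜(M)Ш₁, f⟩ = μ·∑_{n∈ℤ} f(n) for every Schwartz function f : ℝ → ℂ. Then μ is given by the normalized Gauss sum μ = exp(−πi/4)·b^(−1/2)·∑_{n=0}^{b−1} exp(−2πi·E(n)). -/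
open MeasureTheory

/-- The metaplectic operator `𝓜(M)` associated with a real matrix `M = (a b; c d)` with
`ad - bc = 1`, acting on functions `f : ℝ → ℂ`.  Square roots with positive real part are
given by the principal complex power. -/
noncomputable def metaplectic (a b c d : ℝ) (f : ℝ → ℂ) (x : ℝ) : ℂ :=
  if b ≠ 0 then
    (Complex.I * (b : ℂ)) ^ (-(1/2) : ℂ) *
      ∫ y : ℝ, Complex.exp ((Real.pi : ℂ) * Complex.I / (b : ℂ) *
        ((d * x ^ 2 - 2 * x * y + a * y ^ 2 : ℝ) : ℂ)) * f y
  else if 0 < a then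
    (a : ℂ) ^ (-(1/2) : ℂ) * Complex.exp ((Real.pi : ℂ) * Complex.I * ((c / a : ℝ) : ℂ)
      * ((x : ℂ)) ^ 2) * f (x / a)
  else
    -Complex.I * ((-a : ℝ) : ℂ) ^ (-(1/2) : ℂ) *
      Complex.exp ((Real.pi : ℂ) * Complex.I * ((c / a : ℝ) : ℂ) * ((x : ℂ)) ^ 2) * f (x / a)

/-- The pairing `⟨S_{(q/2,p/2)} 𝓜(M) Ш₁, f⟩ = ∑_{n ∈ ℤ} (𝓜(M') g)(n)` where
`M' = (d b; c a)` and `g(x) = exp(πiqp/4 + πipx) f(x + q/2)`. -/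
noncomputable def shiftMetaPair (a b c d q p : ℝ) (f : ℝ → ℂ) : ℂ :=
  ∑' n : ℤ, metaplectic d b c a
    (fun x => Complex.exp ((Real.pi : ℂ) * Complex.I * (q : ℂ) * (p : ℂ) / 4
        + (Real.pi : ℂ) * Complex.I * (p : ℂ) * (x : ℂ)) * f (x + q / 2)) (n : ℝ)

open scoped FourierTransform SchwartzMap ComplexConjugate

/-- The phase `exp(-2πi E(x))` of the Gauss sum, where
`E(x) = -(d/(2b))(x - q/2)² - (1/2)px + (1/8)qp`. -/
noncomputable def gaussPhase (b d q p x : ℝ) : ℂ :=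
  Complex.exp (-2 * (Real.pi : ℂ) * Complex.I *
    ((-(d / (2 * b)) * (x - q / 2) ^ 2 - (1/2) * p * x + (1/8) * q * p : ℝ) : ℂ))

theorem gaussPhase_mul_conj (b d q p x : ℝ) :
    gaussPhase b d q p x * conj (gaussPhase b d q p x) = 1 := by
  unfold gaussPhase
  rw [← Complex.exp_conj, ← Complex.exp_add, ← Complex.exp_zero]
  congr 1
  simp only [map_mul, map_neg, Complex.conj_ofReal, Complex.conj_I, map_ofNat]
  ring

/-- Poisson summation for a Schwartz function, with convergence of the dual series. -/
theorem SchwartzMap.hasSum_integral_exp (f : 𝓢(ℝ, ℂ)) :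
    HasSum (fun m : ℤ => ∫ x : ℝ, Complex.exp (-2 * Real.pi * Complex.I * m * x) * f x)
      (∑' n : ℤ, f n) := by
  have h1 : (fun m : ℤ => ∫ x : ℝ, Complex.exp (-2 * Real.pi * Complex.I * m * x) * f x)
      = fun m : ℤ => (𝓕 f) (m : ℝ) := by
    funext m
    rw [SchwartzMap.fourier_coe, Real.fourier_real_eq_integral_exp_smul]
    refine integral_congr_ae (Filter.Eventually.of_forall fun x => ?_)
    simp only [smul_eq_mul]
    congr 2
    push_cast
    ring
  have hs : Summable fun m : ℤ => (𝓕 f) (m : ℝ) :=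
    summable_of_isBigO (Real.summable_abs_int_rpow one_lt_two)
      (((𝓕 f).isBigO_cocompact_rpow (-2)).comp_tendsto Int.tendsto_coe_cofinite)
  have h2 := f.tsum_eq_tsum_fourier 0
  simp only [zero_add, QuotientAddGroup.mk_zero, fourier_eval_zero, mul_one] at h2
  rw [h1, h2]
  exact hs.hasSum

/-- A series over `ℤ` can be summed along the residue classes modulo `b`. -/
theorem hasSum_int_of_residues {b : ℤ} (hb : 0 < b) {h : ℤ → ℂ} {s : ℕ → ℂ}
    (hs : ∀ r ∈ Finset.range b.toNat, HasSum (fun m : ℤ => h (b * m + r)) (s r)) :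
    HasSum h (∑ r ∈ Finset.range b.toNat, s r) := by
  have key : ∀ r ∈ Finset.range b.toNat,
      HasSum (fun n : ℤ => if n % b = r then h n else 0) (s r) := by
    intro r hr
    rw [Finset.mem_range] at hr
    have hinj : Function.Injective fun m : ℤ => b * m + r := fun x y hxy => by
      simpa [hb.ne'] using hxy
    rw [← hinj.hasSum_iff]
    · convert hs r (Finset.mem_range.2 hr) using 2 with m
      have : (b * m + (r : ℤ)) % b = r := by
        rw [Int.mul_add_emod_self_left]
        exact Int.emod_eq_of_lt (by omega) (by omega)
      simp [this]
    · intro n hn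
      rw [if_neg]
      rintro h'
      exact hn ⟨n / b, by simp only [← h']; exact Int.mul_ediv_add_emod n b⟩
  convert hasSum_sum key using 2 with n
  have h1 := Int.emod_nonneg n hb.ne'
  have h2 := Int.emod_lt_of_pos n hb
  rw [Finset.sum_eq_single (n % b).toNat]
  · rw [if_pos (by omega)]
  · intro r _ hr
    rw [if_neg (by omega)]
  · intro hr
    rw [Finset.mem_range] at hr
    omega

/-- Orthogonality of the additive characters modulo `b`. -/
theorem sum_range_exp_sub {b r s : ℕ} (hr : r < b) (hs : s < b) :
    ∑ k ∈ Finset.range b, Complex.exp (-2 * Real.pi * Complex.I * k * ((r : ℂ) - s) / b)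
      = if r = s then (b : ℂ) else 0 := by
  have hb : (b : ℂ) ≠ 0 := by exact_mod_cast (by omega : b ≠ 0)
  have hpi : (2 * Real.pi * Complex.I : ℂ) ≠ 0 := Complex.two_pi_I_ne_zero
  set ζ := Complex.exp (-2 * Real.pi * Complex.I * ((r : ℂ) - s) / b) with hζ
  have hpow : ∀ k : ℕ,
      Complex.exp (-2 * Real.pi * Complex.I * k * ((r : ℂ) - s) / b) = ζ ^ k := by
    intro k
    rw [hζ, ← Complex.exp_nat_mul]
    congr 1
    ring
  simp only [hpow]
  split_ifs with h
  · have : ζ = 1 := by simp [hζ, h]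
    simp [this]
  · have hne : ζ ≠ 1 := by
      intro h1
      rw [hζ, Complex.exp_eq_one_iff] at h1
      obtain ⟨n, hn⟩ := h1
      have h2 : (2 * Real.pi * Complex.I : ℂ) * ((s : ℂ) - r) =
          (2 * Real.pi * Complex.I : ℂ) * (n * b) := by
        field_simp at hn
        linear_combination (2 * Real.pi * Complex.I : ℂ) * hn
      have h3 : (s : ℤ) - r = n * b := by exact_mod_cast mul_left_cancel₀ hpi h2
      have h4 : n < 1 := by nlinarith
      have h5 : -1 < n := by nlinarith
      have h6 : n = 0 := by omega
      subst h6
      omega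
    have hb1 : ζ ^ b = 1 := by
      rw [← hpow, Complex.exp_eq_one_iff]
      refine ⟨(s : ℤ) - r, ?_⟩
      push_cast
      field_simp
      ring
    rw [geom_sum_eq hne, hb1, sub_self, zero_div]

/-- If the discrete Fourier transform of a unimodular sequence `c` is `K` times the conjugate of
a unimodular sequence `w`, then `K` is the sum of `w`. -/
theorem eq_sum_of_unimodular_dft {b : ℕ} (hb : 0 < b) {c w : ℕ → ℂ} {K : ℂ} (hc0 : c 0 = 1)
    (hc : ∀ r, c r * conj (c r) = 1) (hw : ∀ k, w k * conj (w k) = 1)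
    (hK : ∀ k, K = w k * ∑ r ∈ Finset.range b,
      c r * Complex.exp (-2 * Real.pi * Complex.I * k * r / b)) :
    K = ∑ k ∈ Finset.range b, w k := by
  have hb0 : (b : ℂ) ≠ 0 := by exact_mod_cast hb.ne'
  have hG : ∀ k : ℕ, ∑ r ∈ Finset.range b,
      c r * Complex.exp (-2 * Real.pi * Complex.I * k * r / b) = conj (w k) * K := by
    intro k
    linear_combination (-conj (w k)) * hK k - (∑ r ∈ Finset.range b,
      c r * Complex.exp (-2 * Real.pi * Complex.I * k * r / b)) * hw k
  have hsum : K * conj (∑ k ∈ Finset.range b, w k) = b := by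
    rw [map_sum, mul_comm, Finset.sum_mul, Finset.sum_congr rfl fun k _ => (hG k).symm,
      Finset.sum_comm]
    have : ∀ r ∈ Finset.range b, ∑ k ∈ Finset.range b,
        c r * Complex.exp (-2 * Real.pi * Complex.I * k * r / b) =
          if r = 0 then (b : ℂ) else 0 := by
      intro r hr
      have h := sum_range_exp_sub (Finset.mem_range.1 hr) hb
      simp only [Nat.cast_zero, sub_zero] at h
      rw [← Finset.mul_sum, h]
      split_ifs with h0
      · rw [h0, hc0, one_mul]
      · rw [mul_zero]
    rw [Finset.sum_congr rfl this]
    simp [hb.ne']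
  have hnorm : K * conj K = b := by
    have h1 : ∑ k ∈ Finset.range b, (conj (w k) * K) * conj (conj (w k) * K) = b * b := by
      calc _ = ∑ k ∈ Finset.range b, ∑ r ∈ Finset.range b, ∑ s ∈ Finset.range b,
              (c r * conj (c s)) *
                Complex.exp (-2 * Real.pi * Complex.I * k * ((r : ℂ) - s) / b) := by
            refine Finset.sum_congr rfl fun k _ => ?_
            rw [← hG, map_sum, Finset.sum_mul_sum]
            refine Finset.sum_congr rfl fun r _ => Finset.sum_congr rfl fun s _ => ?_
            rw [map_mul, mul_mul_mul_comm, ← Complex.exp_conj, ← Complex.exp_add]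
            congr 2
            simp only [map_mul, map_div₀, map_neg, Complex.conj_ofReal, Complex.conj_I,
              map_ofNat, map_natCast]
            ring
        _ = ∑ r ∈ Finset.range b, ∑ s ∈ Finset.range b, if r = s then (b : ℂ) else 0 := by
            rw [Finset.sum_comm]
            refine Finset.sum_congr rfl fun r hr => ?_
            rw [Finset.sum_comm]
            refine Finset.sum_congr rfl fun s hs => ?_
            rw [← Finset.mul_sum,
              sum_range_exp_sub (Finset.mem_range.1 hr) (Finset.mem_range.1 hs)]
            split_ifs with h
            · rw [h, hc, one_mul]
            · rw [mul_zero]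
        _ = b * b := by
            rw [Finset.sum_congr rfl fun r hr => by rw [Finset.sum_ite_eq, if_pos hr]]
            simp
    have h2 : ∀ k ∈ Finset.range b, (conj (w k) * K) * conj (conj (w k) * K) = K * conj K := by
      intro k _
      rw [map_mul, Complex.conj_conj]
      linear_combination (K * conj K) * hw k
    rw [Finset.sum_congr rfl h2, Finset.sum_const, Finset.card_range, nsmul_eq_mul] at h1
    exact mul_left_cancel₀ hb0 h1
  have hK0 : K ≠ 0 := fun h => hb0 (by rw [← hnorm, h, zero_mul])
  exact (starRingEnd ℂ).injective (mul_left_cancel₀ hK0 (hnorm.trans hsum.symm))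

/-- The summand of `shiftMetaPair` at `b m + r` is a Fourier integral at frequency `m`. -/
theorem metaplectic_shift_apply {a b c d q p : ℤ} (hb : b ≠ 0) (hq : q ≡ a * b [ZMOD 2])
    (f : ℝ → ℂ) (m : ℤ) (r : ℕ) :
    metaplectic (d : ℝ) (b : ℝ) (c : ℝ) (a : ℝ)
      (fun x => Complex.exp ((Real.pi : ℂ) * Complex.I * ((q : ℝ) : ℂ) * ((p : ℝ) : ℂ) / 4
        + (Real.pi : ℂ) * Complex.I * ((p : ℝ) : ℂ) * (x : ℂ)) * f (x + (q : ℝ) / 2))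
        (((b * m + r : ℤ)) : ℝ) =
      (Complex.I * ((b : ℝ) : ℂ)) ^ (-(1/2) : ℂ) *
        (Complex.exp (Real.pi * Complex.I * (a * r ^ 2 + q * r) / b) *
          ∫ x : ℝ, Complex.exp (-2 * Real.pi * Complex.I * m * x) *
            (Complex.exp (-2 * Real.pi * Complex.I * x * r / b) *
              (gaussPhase b d q p x * f x))) := by
  have hbR : (b : ℝ) ≠ 0 := by exact_mod_cast hb
  have hbC : (b : ℂ) ≠ 0 := by exact_mod_cast hb
  obtain ⟨j, hj⟩ : ∃ j : ℤ, a * b * m ^ 2 + q * m = 2 * j := by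
    have h1 : a * b * m ^ 2 + q * m ≡ 0 [ZMOD 2] := by
      calc a * b * m ^ 2 + q * m ≡ a * b * m ^ 2 + a * b * m [ZMOD 2] :=
            Int.ModEq.add_left _ (hq.mul_right _)
        _ = a * b * (m * (m + 1)) := by ring
        _ ≡ 0 [ZMOD 2] :=
            Int.modEq_zero_iff_dvd.2 (((Int.even_mul_succ_self m).two_dvd).mul_left _)
    exact Int.modEq_zero_iff_dvd.1 h1
  have hjC : (a : ℂ) * b * m ^ 2 + q * m = 2 * j := by exact_mod_cast hj
  rw [metaplectic, if_pos hbR]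
  congr 1
  symm
  rw [← integral_const_mul, ← integral_add_right_eq_self _ ((q : ℝ) / 2)]
  refine integral_congr_ae (Filter.Eventually.of_forall fun y => ?_)
  simp only [gaussPhase]
  rw [← mul_assoc, ← mul_assoc, ← mul_assoc, ← mul_assoc, ← Complex.exp_add, ← Complex.exp_add,
    ← Complex.exp_add, ← Complex.exp_add]
  congr 1
  rw [Complex.exp_eq_exp_iff_exists_int]
  refine ⟨-(j + a * m * r), ?_⟩
  push_cast
  field_simp
  linear_combination (-128 * b : ℂ) * hjC

/-- The series defining `shiftMetaPair`, evaluated by Poisson summation on a smooth compactly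
supported function. -/
theorem shiftMetaPair_eq {a b c d q p : ℤ} (hb : 0 < b) (hq : q ≡ a * b [ZMOD 2])
    {f : ℝ → ℂ} (hf : ContDiff ℝ (⊤ : ℕ∞) f) (hfs : HasCompactSupport f) :
    shiftMetaPair (a : ℝ) (b : ℝ) (c : ℝ) (d : ℝ) (q : ℝ) (p : ℝ) f =
      (Complex.I * ((b : ℝ) : ℂ)) ^ (-(1/2) : ℂ) * ∑ r ∈ Finset.range b.toNat,
        Complex.exp (Real.pi * Complex.I * (a * r ^ 2 + q * r) / b) *
          ∑' k : ℤ, Complex.exp (-2 * Real.pi * Complex.I * k * r / b) *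
              (gaussPhase b d q p k * f k) := by
  unfold shiftMetaPair
  rw [Finset.mul_sum]
  refine (hasSum_int_of_residues hb fun r _ => ?_).tsum_eq
  simp only [metaplectic_shift_apply hb.ne' hq]
  refine HasSum.mul_left _ (HasSum.mul_left _ ?_)
  have hF : ContDiff ℝ (⊤ : ℕ∞) fun x : ℝ =>
      Complex.exp (-2 * Real.pi * Complex.I * x * r / b) * (gaussPhase b d q p x * f x) := by
    have hof : ContDiff ℝ (⊤ : ℕ∞) (fun x : ℝ => (x : ℂ)) := Complex.ofRealCLM.contDiff
    unfold gaussPhase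
    push_cast
    fun_prop
  have hFs : HasCompactSupport fun x : ℝ =>
      Complex.exp (-2 * Real.pi * Complex.I * x * r / b) * (gaussPhase b d q p x * f x) :=
    (hfs.mul_left (f := fun x : ℝ => gaussPhase b d q p x)).mul_left
      (f := fun x : ℝ => Complex.exp (-2 * Real.pi * Complex.I * x * r / b))
  simpa using (hFs.toSchwartzMap hF).hasSum_integral_exp

/-- Integer points are separated by smooth compactly supported functions. -/
theorem exists_contDiff_int_single (k : ℤ) : ∃ f : ℝ → ℂ, ContDiff ℝ (⊤ : ℕ∞) f ∧
    HasCompactSupport f ∧ f k = 1 ∧ ∀ n : ℤ, n ≠ k → f n = 0 := by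
  let φ : ContDiffBump (k : ℝ) := ⟨1/4, 1/2, by norm_num, by norm_num⟩
  refine ⟨fun x => (φ x : ℂ), Complex.ofRealCLM.contDiff.comp φ.contDiff,
    φ.hasCompactSupport.comp_left (g := fun x : ℝ => (x : ℂ)) Complex.ofReal_zero, ?_, ?_⟩
  · simp [φ.one_of_mem_closedBall (Metric.mem_closedBall_self φ.rIn_pos.le)]
  · intro n hn
    have h : φ.rOut ≤ dist (n : ℝ) k := by
      rw [Int.dist_cast_real, Int.dist_eq]
      have h1 : (1 : ℤ) ≤ |n - k| := Int.one_le_abs (sub_ne_zero.2 hn)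
      have h2 : (1 : ℝ) ≤ |(n : ℝ) - k| := by exact_mod_cast h1
      exact le_trans (by norm_num [φ]) h2
    simp [φ.zero_of_le_dist h]

theorem I_mul_cpow_neg_half {b : ℝ} (hb : 0 < b) :
    (Complex.I * (b : ℂ)) ^ (-(1/2) : ℂ) =
      Complex.exp (-(Real.pi : ℂ) * Complex.I / 4) * (b : ℂ) ^ (-(1/2) : ℂ) := by
  have hbC : (b : ℂ) ≠ 0 := by exact_mod_cast hb.ne'
  rw [mul_comm Complex.I, Complex.cpow_def_of_ne_zero (mul_ne_zero hbC Complex.I_ne_zero),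
    Complex.cpow_def_of_ne_zero hbC, Complex.log_ofReal_mul hb Complex.I_ne_zero, Complex.log_I,
    Complex.ofReal_log hb.le, ← Complex.exp_add]
  congr 1
  ring

/-- The eigenvalue `μ(M; (q,p))` is given by a normalized Gauss sum:
`μ = e^{-πi/4} b^{-1/2} ∑_{n=0}^{b-1} e^{-2πi E(n)}` with
`E(n) = -(d/(2b))(n - q/2)² - (1/2)pn + (1/8)qp`. -/
theorem stmt19 (a b c d q p : ℤ) (hdet : a * d - b * c = 1) (hb : 0 < b)
    (hq : q ≡ a * b [ZMOD 2]) (hp : p ≡ c * d [ZMOD 2]) (μ : ℂ)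
    (hμ : ∀ f : SchwartzMap ℝ ℂ,
      shiftMetaPair (a : ℝ) (b : ℝ) (c : ℝ) (d : ℝ) (q : ℝ) (p : ℝ) (⇑f)
        = μ * ∑' n : ℤ, f (n : ℝ)) :
    μ = Complex.exp (-(Real.pi : ℂ) * Complex.I / 4) * ((b : ℝ) : ℂ) ^ (-(1/2) : ℂ) *
      ∑ n ∈ Finset.range b.toNat,
        Complex.exp (-2 * (Real.pi : ℂ) * Complex.I *
          ((-((d : ℝ) / (2 * (b : ℝ))) * ((n : ℝ) - (q : ℝ) / 2) ^ 2
            - (1/2) * (p : ℝ) * (n : ℝ) + (1/8) * (q : ℝ) * (p : ℝ) : ℝ) : ℂ)) := by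
  have hbR : (0 : ℝ) < b := by exact_mod_cast hb
  have hbn : ((b.toNat : ℕ) : ℂ) = b := by exact_mod_cast Int.toNat_of_nonneg hb.le
  set C : ℂ := (Complex.I * ((b : ℝ) : ℂ)) ^ (-(1/2) : ℂ) with hC
  have hC0 : C ≠ 0 := by
    rw [hC, Complex.cpow_def_of_ne_zero
      (mul_ne_zero Complex.I_ne_zero (by exact_mod_cast hb.ne'))]
    exact Complex.exp_ne_zero _
  have hμC : ∀ k : ℕ, μ / C = gaussPhase b d q p k * ∑ r ∈ Finset.range b.toNat,
      Complex.exp (Real.pi * Complex.I * (a * r ^ 2 + q * r) / b) *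
        Complex.exp (-2 * Real.pi * Complex.I * k * r / (b.toNat : ℕ)) := by
    intro k
    obtain ⟨f, hf, hfs, hf1, hf0⟩ := exists_contDiff_int_single k
    have h1 : shiftMetaPair (a : ℝ) (b : ℝ) (c : ℝ) (d : ℝ) (q : ℝ) (p : ℝ) f
        = μ * ∑' n : ℤ, f n := hμ (hfs.toSchwartzMap hf)
    rw [shiftMetaPair_eq hb hq hf hfs, tsum_eq_single (k : ℤ) hf0, hf1, mul_one] at h1
    rw [div_eq_iff hC0, ← h1, ← hC, hbn, mul_comm _ C, Finset.mul_sum (a := gaussPhase _ _ _ _ _)]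
    congr 1
    refine Finset.sum_congr rfl fun r _ => ?_
    rw [tsum_eq_single (k : ℤ) fun n hn => by rw [hf0 n hn, mul_zero, mul_zero], hf1]
    simp only [Int.cast_natCast]
    ring
  have key := eq_sum_of_unimodular_dft (b := b.toNat) (by omega)
    (c := fun r => Complex.exp (Real.pi * Complex.I * (a * r ^ 2 + q * r) / b))
    (w := fun k => gaussPhase b d q p k) (K := μ / C) (by simp)
    (fun r => by
      rw [← Complex.exp_conj, ← Complex.exp_add, ← Complex.exp_zero]
      congr 1
      simp only [map_mul, map_div₀, map_add, map_pow, Complex.conj_ofReal, Complex.conj_I,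
        map_natCast, map_intCast]
      ring)
    (fun k => gaussPhase_mul_conj _ _ _ _ _) hμC
  rw [div_eq_iff hC0, hC, I_mul_cpow_neg_half hbR, mul_comm] at key
  exact key
end
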